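/- Let ψ ∈ C³ be a 3-cochain on g and set D := d + e_ψ, an odd operator on the space of cochains. Denote by [P,Q]_+ := P∘Q + Q∘P the anticommutator of two odd operators and by [P,Q]_− := P∘Q − Q∘P the commutator. Then for all x, y ∈ g and ξ, η ∈ C¹ = g*: (a) [[i_x, D]_+, i_y]_− = i_{[x,y]} − e_{ψ(x,y,·)}, where ψ(x,y,·) ∈ C¹ is z ↦ ψ(x,y,z); (b) [[i_x, D]_+, e_ξ]_− = e_{ad*_x ξ}, where (ad*_x ξ)(y) = −ξ([x,y]); (c) [[e_ξ, D]_+, i_x]_− = −e_{i_x dξ}; (d) [[e_ξ, D]_+, e_η]_− = 0. (That is, d + e_ψ is a deriving operator for the Courant bracket with background ψ on g ⊕ g*, the Lie-algebra case of the double of the quasi-Lie bialgebroid with trivial cobracket and background ψ.) -/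

import Mathlib

/-! **`D = d + e_ψ` is a deriving operator for the Courant bracket with
background `ψ` on `g ⊕ g*`** (Lie-algebra case of the double of the quasi-Lie
bialgebroid with trivial cobracket and background `ψ`).

Cochains of degree `n` on a Lie algebra `g` are alternating `n`-linear forms
(`C⁰ = K`, `C¹ = g*`); they carry the shuffle wedge product, the contraction
`i_x`, and the Chevalley–Eilenberg differential `d`.  The operators below are
defined by their defining formulas on arbitrary families of `n`-ary forms, and
the operator identities (a)–(d) are asserted on every cochain, i.e. every
family `ω` of alternating forms. -/

open scoped Classical

section DerivingOperator

variable (K : Type*) [Field K] [CharZero K] (g : Type*) [LieRing g] [LieAlgebra K g]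

/-- `n`-ary forms on `g` (the carrier of formulas for degree-`n` cochains). -/
abbrev RawCochain (n : ℕ) := (Fin n → g) → K

/-- Families of `n`-ary forms, one in each degree. -/
abbrev RawCochains := ∀ n : ℕ, RawCochain K g n

/-- The space `Cⁿ` of alternating `n`-linear forms on `g`. -/
abbrev Cochain (n : ℕ) := g [⋀^Fin n]→ₗ[K] K

/-- The shuffle wedge product of a `p`-form and a `q`-form:
`(α∧β)(x_1,…,x_{p+q}) = Σ_σ sgn(σ) α(x_{σ(1)},…,x_{σ(p)}) β(x_{σ(p+1)},…,x_{σ(p+q)})`,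
the sum being over the `(p,q)`-shuffles `σ`. -/
noncomputable def wedgeRaw {p q : ℕ} (α : RawCochain K g p) (β : RawCochain K g q) :
    RawCochain K g (q + p) := fun v =>
  ∑ σ : Equiv.Perm (Fin (q + p)),
    if (∀ i j : Fin p, i < j →
          σ ⟨i.1, by have := i.isLt; omega⟩ < σ ⟨j.1, by have := j.isLt; omega⟩) ∧
       (∀ i j : Fin q, i < j →
          σ ⟨p + i.1, by have := i.isLt; omega⟩ < σ ⟨p + j.1, by have := j.isLt; omega⟩)
    then
      ((Equiv.Perm.sign σ : ℤ) : K)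
        * α (fun i => v (σ ⟨i.1, by have := i.isLt; omega⟩))
        * β (fun i => v (σ ⟨p + i.1, by have := i.isLt; omega⟩))
    else 0

/-- The Chevalley–Eilenberg differential `d : Cⁿ → Cⁿ⁺¹`,
`(dω)(x_0,…,x_n) = Σ_{i<j} (−1)^{i+j} ω(⁅x_i,x_j⁆, x_0, …, x̂_i, …, x̂_j, …, x_n)`
(hats denote omitted arguments, the remaining ones taken in increasing order). -/
noncomputable def ceDRaw {n : ℕ} (ω : RawCochain K g n) : RawCochain K g (n + 1) :=
  fun v =>
    ∑ j : Fin (n + 1), ∑ i : Fin (n + 1),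
      if (i : ℕ) < (j : ℕ) then
        ((-1 : K) ^ ((i : ℕ) + (j : ℕ)))
          * ω (fun k : Fin n =>
              if (k : ℕ) = 0 then ⁅v i, v j⁆
              else v ⟨if (k : ℕ) - 1 < (i : ℕ) then (k : ℕ) - 1
                      else if (k : ℕ) < (j : ℕ) then (k : ℕ) else (k : ℕ) + 1,
                      by have := k.isLt; split_ifs <;> omega⟩)
      else 0

/-- The contraction `i_x` acting on families of forms:
`(i_x ω)(x_1,…,x_n) = ω(x, x_1,…,x_n)`. -/
def contrOp (x : g) : RawCochains K g → RawCochains K g :=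
  fun ω n v => ω (n + 1) (Fin.cons x v)

/-- Left multiplication `e_α = α ∧ ·` by a `p`-form `α`, acting on families of
forms. -/
noncomputable def mulOp {p : ℕ} (α : RawCochain K g p) :
    RawCochains K g → RawCochains K g := fun ω n =>
  if h : p ≤ n then
    cast (congrArg (RawCochain K g) (Nat.sub_add_cancel h)) (wedgeRaw K g α (ω (n - p)))
  else 0

/-- The Chevalley–Eilenberg differential acting on families of forms. -/
noncomputable def dOp : RawCochains K g → RawCochains K g :=
  fun ω n => match n with
    | 0 => 0
    | (m + 1) => ceDRaw K g (ω m)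

/-- The family of forms underlying a cochain (a family of alternating forms). -/
def toRaw (ω : ∀ n : ℕ, Cochain K g n) : RawCochains K g := fun n => ⇑(ω n)

/-- Coadjoint action: `(coad x ξ) y = −ξ ⁅x, y⁆`. -/
def coad (x : g) (ξ : Module.Dual K g) : Module.Dual K g :=
  - (ξ ∘ₗ (LieAlgebra.ad K g x : g →ₗ[K] g))

/-- The anticommutator `[P,Q]₊ = P∘Q + Q∘P` of two (odd) operators. -/
def acommOp (P Q : RawCochains K g → RawCochains K g) :
    RawCochains K g → RawCochains K g := fun ω => P (Q ω) + Q (P ω)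

/-- The commutator `[P,Q]₋ = P∘Q − Q∘P` of two operators. -/
def commOp (P Q : RawCochains K g → RawCochains K g) :
    RawCochains K g → RawCochains K g := fun ω => P (Q ω) - Q (P ω)

section Cartan

variable {F : Type*} [Field F] {L : Type*}

/-- The permutation of `Fin (n + 1)` sending `k` to `0` and restricting to `τ` between the
complements of `k` and of `0`. -/
def permInsert {n : ℕ} (k : Fin (n + 1)) (τ : Equiv.Perm (Fin n)) : Equiv.Perm (Fin (n + 1)) :=
  Equiv.Perm.decomposeFin.symm (0, τ) * k.cycleRange

lemma permInsert_self {n : ℕ} (k : Fin (n + 1)) (τ : Equiv.Perm (Fin n)) :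
    permInsert k τ k = 0 := by
  simp [permInsert]

lemma permInsert_succAbove {n : ℕ} (k : Fin (n + 1)) (τ : Equiv.Perm (Fin n)) (i : Fin n) :
    permInsert k τ (k.succAbove i) = (τ i).succ := by
  simp [permInsert, Fin.cycleRange_succAbove]

lemma sign_permInsert {n : ℕ} (k : Fin (n + 1)) (τ : Equiv.Perm (Fin n)) :
    Equiv.Perm.sign (permInsert k τ) = (-1) ^ (k : ℕ) * Equiv.Perm.sign τ := by
  simp [permInsert, Equiv.Perm.decomposeFin.symm_sign, Fin.sign_cycleRange, mul_comm]

lemma permInsert_of_lt {n : ℕ} (k : Fin (n + 1)) (τ : Equiv.Perm (Fin n)) (i : ℕ) (hi : i < n)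
    (h : i < k) : permInsert k τ ⟨i, by omega⟩ = (τ ⟨i, hi⟩).succ := by
  rw [← permInsert_succAbove k τ, Fin.succAbove_of_castSucc_lt _ _ (by simpa [Fin.lt_def])]
  rfl

lemma permInsert_of_le {n : ℕ} (k : Fin (n + 1)) (τ : Equiv.Perm (Fin n)) (i : ℕ) (hi : i < n)
    (h : k ≤ i) : permInsert k τ ⟨i + 1, by omega⟩ = (τ ⟨i, hi⟩).succ := by
  rw [← permInsert_succAbove k τ, Fin.succAbove_of_le_castSucc _ _ (by simpa [Fin.le_def])]
  rfl

lemma permInsert_bijective (n : ℕ) : Function.Bijective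
    (fun a : Fin (n + 1) × Equiv.Perm (Fin n) => permInsert a.1 a.2) := by
  rw [Fintype.bijective_iff_injective_and_card]
  constructor
  · rintro ⟨k, τ⟩ ⟨l, ρ⟩ h
    simp only at h
    have hkl : k = l := by
      apply (permInsert l ρ).injective
      rw [permInsert_self, ← h, permInsert_self]
    subst hkl
    have : τ = ρ := Equiv.ext fun i => Fin.succ_injective _ <| by
      rw [← permInsert_succAbove k τ, ← permInsert_succAbove k ρ, h]
    rw [this]
  · simp [Fintype.card_perm, Nat.factorial_succ]

lemma sum_perm_succ {n : ℕ} (f : Equiv.Perm (Fin (n + 1)) → F) :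
    ∑ σ, f σ = ∑ k, ∑ τ, f (permInsert k τ) := by
  rw [← Fintype.sum_prod_type', (permInsert_bijective n).sum_comp f]

/-- `σ` is increasing on the first `p` and on the next `q` elements of `Fin n`. -/
def IsShuffle {n : ℕ} (p q : ℕ) (h : p + q = n) (σ : Equiv.Perm (Fin n)) : Prop :=
  (∀ i j : Fin p, i < j → σ ⟨i.1, by omega⟩ < σ ⟨j.1, by omega⟩) ∧
    (∀ i j : Fin q, i < j → σ ⟨p + i.1, by omega⟩ < σ ⟨p + j.1, by omega⟩)

/-- The summand of the wedge product indexed by `σ`, in total degree `n = p + q`. -/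
def wedgeTerm {n : ℕ} (p q : ℕ) (h : p + q = n) (α : RawCochain F L p) (β : RawCochain F L q)
    (v : Fin n → L) (σ : Equiv.Perm (Fin n)) : F :=
  ((Equiv.Perm.sign σ : ℤ) : F) * α (fun i => v (σ ⟨i.1, by omega⟩))
    * β (fun i => v (σ ⟨p + i.1, by omega⟩))

lemma mulOp_apply {p q n : ℕ} (h : p + q = n) (α : RawCochain F L p) (ω : RawCochains F L)
    (v : Fin n → L) : mulOp F L α ω n v =
      ∑ σ, if IsShuffle p q h σ then wedgeTerm p q h α (ω q) v σ else 0 := by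
  obtain rfl : q = n - p := by omega
  have key : ∀ (m : ℕ) (e : n - p + p = m) (h' : p + (n - p) = m) (w : Fin m → L),
      cast (congrArg (RawCochain F L) e) (wedgeRaw F L α (ω (n - p))) w =
      ∑ σ, if IsShuffle p (n - p) h' σ then wedgeTerm p (n - p) h' α (ω (n - p)) w σ else 0 := by
    rintro m rfl h' w
    refine Finset.sum_congr rfl fun σ _ => ?_
    simp only [IsShuffle, wedgeTerm]
    congr 1
  rw [mulOp, dif_pos (by omega)]
  exact key n (by omega) h v

lemma mulOp_of_lt {p n : ℕ} (h : n < p) (α : RawCochain F L p) (ω : RawCochains F L) :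
    mulOp F L α ω n = 0 := dif_neg (by omega)

lemma isShuffle_permInsert_zero {n p q : ℕ} (h : p + q = n) (τ : Equiv.Perm (Fin n)) :
    IsShuffle (p + 1) q (by omega) (permInsert 0 τ) ↔ IsShuffle p q h τ := by
  have hs : ∀ (i : ℕ) (hi : i < n), permInsert 0 τ ⟨i + 1, by omega⟩ = (τ ⟨i, hi⟩).succ :=
    fun i hi => permInsert_of_le 0 τ i hi (Nat.zero_le i)
  have h0 : permInsert 0 τ ⟨0, by omega⟩ = 0 := permInsert_self 0 τ
  have ha : ∀ i : Fin q, permInsert 0 τ ⟨p + 1 + i, by omega⟩ = (τ ⟨p + i, by omega⟩).succ := by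
    intro i
    rw [← hs]
    congr 2
    omega
  refine and_congr ⟨fun H i j hij => ?_, fun H i j hij => ?_⟩
    (by simp only [ha, Fin.succ_lt_succ_iff])
  · have := H i.succ j.succ (by simpa)
    simpa only [Fin.val_succ, hs _ (show (i : ℕ) < n by omega), hs _ (show (j : ℕ) < n by omega),
      Fin.succ_lt_succ_iff] using this
  · induction j using Fin.cases with
    | zero => simp at hij
    | succ j =>
      have hj := hs j (by omega)
      induction i using Fin.cases with
      | zero =>
        simp only [Fin.val_succ, hj, Fin.val_zero, h0]
        exact Fin.succ_pos _
      | succ i =>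
        simpa only [Fin.val_succ, hs _ (show (i : ℕ) < n by omega), hj, Fin.succ_lt_succ_iff] using
          H i j (by simpa using hij)

lemma isShuffle_permInsert_mid {n p q : ℕ} (h : p + q = n) (τ : Equiv.Perm (Fin n)) :
    IsShuffle p (q + 1) (by omega) (permInsert ⟨p, by omega⟩ τ) ↔ IsShuffle p q h τ := by
  have hl : ∀ i : Fin p, permInsert ⟨p, by omega⟩ τ ⟨i, by omega⟩ = (τ ⟨i, by omega⟩).succ :=
    fun i => permInsert_of_lt _ τ i _ i.2
  have hs : ∀ i : Fin q, permInsert ⟨p, by omega⟩ τ ⟨p + (i + 1), by omega⟩ =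
      (τ ⟨p + i, by omega⟩).succ :=
    fun i => permInsert_of_le _ τ (p + i) _ (by simp)
  have h0 : permInsert ⟨p, by omega⟩ τ ⟨p + 0, by omega⟩ = 0 := permInsert_self _ τ
  refine and_congr (by simp only [hl, Fin.succ_lt_succ_iff])
    ⟨fun H i j hij => ?_, fun H i j hij => ?_⟩
  · have := H i.succ j.succ (by simpa)
    simpa only [Fin.val_succ, hs, Fin.succ_lt_succ_iff] using this
  · induction j using Fin.cases with
    | zero => simp at hij
    | succ j =>
      induction i using Fin.cases with
      | zero =>
        simp only [Fin.val_succ, hs, Fin.val_zero, h0]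
        exact Fin.succ_pos _
      | succ i =>
        simpa only [Fin.val_succ, hs, Fin.succ_lt_succ_iff] using H i j (by simpa using hij)

/-- In a shuffle, only the first element of either block can be sent to `0`. -/
lemma IsShuffle.eq_zero_or_eq {n p q : ℕ} {h : p + q = n + 1} {k : Fin (n + 1)}
    {τ : Equiv.Perm (Fin n)} (H : IsShuffle p q h (permInsert k τ)) : (k : ℕ) = 0 ∨ (k : ℕ) = p := by
  by_contra! hk
  have hself := permInsert_self k τ
  rcases lt_or_ge (k : ℕ) p with hp | hp
  · have := H.1 ⟨k - 1, by omega⟩ ⟨k, hp⟩ (by rw [Fin.mk_lt_mk]; omega)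
    simp only [Fin.eta, hself] at this
    exact Fin.not_lt_zero _ this
  · have := H.2 ⟨k - p - 1, by omega⟩ ⟨k - p, by omega⟩ (by rw [Fin.mk_lt_mk]; omega)
    have hk' : (⟨p + (k - p), by omega⟩ : Fin (n + 1)) = k := Fin.ext (by simp; omega)
    simp only [hk', hself] at this
    exact Fin.not_lt_zero _ this

lemma wedgeTerm_permInsert_zero {n p q : ℕ} (h : p + q = n) (α : RawCochain F L (p + 1))
    (β : RawCochain F L q) (x : L) (v : Fin n → L) (τ : Equiv.Perm (Fin n)) :
    wedgeTerm (p + 1) q (by omega) α β (Fin.cons x v) (permInsert 0 τ) =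
      wedgeTerm p q h (fun w => α (Fin.cons x w)) β v τ := by
  have hs : ∀ (i : ℕ) (hi : i < n), permInsert 0 τ ⟨i + 1, by omega⟩ = (τ ⟨i, hi⟩).succ :=
    fun i hi => permInsert_of_le 0 τ i hi (Nat.zero_le i)
  have h0 : permInsert 0 τ ⟨0, by omega⟩ = 0 := permInsert_self 0 τ
  simp only [wedgeTerm, sign_permInsert]
  congr 1
  · congr 1
    · simp
    · congr 1
      funext i
      induction i using Fin.cases with
      | zero => simp only [Fin.val_zero, h0, Fin.cons_zero]
      | succ i => simp only [Fin.val_succ, hs _ (show (i : ℕ) < n by omega), Fin.cons_succ]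
  · congr 1
    funext i
    have : permInsert 0 τ ⟨p + 1 + i, by omega⟩ = (τ ⟨p + i, by omega⟩).succ := by
      rw [← hs]
      congr 2
      omega
    rw [this, Fin.cons_succ]

lemma wedgeTerm_permInsert_mid {n p q : ℕ} (h : p + q = n) (α : RawCochain F L p)
    (β : RawCochain F L (q + 1)) (x : L) (v : Fin n → L) (τ : Equiv.Perm (Fin n)) :
    wedgeTerm p (q + 1) (by omega) α β (Fin.cons x v) (permInsert ⟨p, by omega⟩ τ) =
      (-1) ^ p * wedgeTerm p q h α (fun w => β (Fin.cons x w)) v τ := by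
  have hl : ∀ i : Fin p, permInsert ⟨p, by omega⟩ τ ⟨i, by omega⟩ = (τ ⟨i, by omega⟩).succ :=
    fun i => permInsert_of_lt _ τ i _ i.2
  have hs : ∀ i : Fin q, permInsert ⟨p, by omega⟩ τ ⟨p + (i + 1), by omega⟩ =
      (τ ⟨p + i, by omega⟩).succ :=
    fun i => permInsert_of_le _ τ (p + i) _ (by simp)
  have h0 : permInsert ⟨p, by omega⟩ τ ⟨p + 0, by omega⟩ = 0 := permInsert_self _ τ
  simp only [wedgeTerm, sign_permInsert, hl, Fin.cons_succ, ← mul_assoc]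
  congr 1
  · simp
  · congr 1
    funext i
    induction i using Fin.cases with
    | zero => simp only [Fin.val_zero, h0, Fin.cons_zero]
    | succ i => simp only [Fin.val_succ, hs, Fin.cons_succ]

/-- Contraction is an antiderivation of the wedge product. -/
lemma contrOp_mulOp {p : ℕ} (x : L) (α : RawCochain F L (p + 1)) (ω : RawCochains F L) :
    contrOp F L x (mulOp F L α ω) = mulOp F L (fun w => α (Fin.cons x w)) ω
      + (-1 : F) ^ (p + 1) • mulOp F L α (contrOp F L x ω) := by
  funext n v
  simp only [Pi.add_apply, Pi.smul_apply, smul_eq_mul]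
  change mulOp F L α ω (n + 1) (Fin.cons x v) = _
  rcases lt_trichotomy n p with hn | rfl | hn
  · rw [mulOp_of_lt (by omega), mulOp_of_lt (by omega), mulOp_of_lt (by omega)]
    simp
  · rw [mulOp_of_lt (Nat.lt_succ_self n), mulOp_apply (q := 0) rfl,
      mulOp_apply (q := 0) (add_zero n),
      sum_perm_succ, Finset.sum_eq_single 0]
    · simp only [isShuffle_permInsert_zero (n := n) (q := 0) rfl,
        wedgeTerm_permInsert_zero (n := n) (q := 0) rfl]
      simp
    · intro k _ hk
      refine Finset.sum_eq_zero fun τ _ => if_neg fun H => ?_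
      rcases H.eq_zero_or_eq with h | h
      · exact hk (Fin.ext h)
      · omega
    · simp
  · obtain ⟨q, rfl⟩ : ∃ q, n = p + 1 + q := ⟨n - (p + 1), by omega⟩
    rw [mulOp_apply (q := q + 1) (by omega), mulOp_apply (q := q + 1) (by omega),
      mulOp_apply (q := q) (by omega), sum_perm_succ,
      ← Finset.sum_subset (Finset.subset_univ {0, ⟨p + 1, by omega⟩}), Finset.sum_pair]
    · simp only [isShuffle_permInsert_zero (show p + (q + 1) = p + 1 + q by omega),
        wedgeTerm_permInsert_zero (show p + (q + 1) = p + 1 + q by omega),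
        isShuffle_permInsert_mid (show p + 1 + q = p + 1 + q by omega),
        wedgeTerm_permInsert_mid (show p + 1 + q = p + 1 + q by omega), Finset.mul_sum, mul_ite,
        mul_zero]
      rfl
    · simp [Fin.ext_iff]
    · intro k _ hk
      refine Finset.sum_eq_zero fun τ _ => if_neg fun H => hk ?_
      rcases H.eq_zero_or_eq with h | h <;> simp [Fin.ext_iff, h]

lemma mulOp_zero_form (α : RawCochain F L 0) (ω : RawCochains F L) :
    mulOp F L α ω = α Fin.elim0 • ω := by
  funext n v
  rw [mulOp_apply (zero_add n), Finset.sum_eq_single 1]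
  · rw [if_pos]
    · simp only [wedgeTerm, Pi.smul_apply, smul_eq_mul, Equiv.Perm.sign_one, Units.val_one,
        Int.cast_one, one_mul, Equiv.Perm.one_apply, zero_add, Fin.eta]
      congr 2
      exact Subsingleton.elim _ _
    · exact ⟨fun i => i.elim0, fun i j hij => by simpa using hij⟩
  · intro σ _ hσ
    refine if_neg fun H => hσ ?_
    have hm : StrictMono σ := fun i j hij => by simpa using H.2 i j hij
    ext i
    have := Subsingleton.elim (hm.orderIsoOfSurjective σ σ.surjective) (OrderIso.refl (Fin n))
    simpa using congrArg (fun e : Fin n ≃o Fin n => (e i : ℕ)) this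
  · simp

lemma mulOp_sum_apply {p : ℕ} (α : RawCochain F L p) (ω : RawCochains F L) (n : ℕ)
    (v : Fin n → L) : mulOp F L α ω n v = if h : p ≤ n then
      ∑ σ, if IsShuffle p (n - p) (by omega) σ then
        wedgeTerm p (n - p) (by omega) α (ω (n - p)) v σ else 0 else 0 := by
  split_ifs with h
  · exact mulOp_apply _ α ω v
  · rw [mulOp_of_lt (by omega), Pi.zero_apply]

lemma mulOp_add {p : ℕ} (α : RawCochain F L p) (ω θ : RawCochains F L) :
    mulOp F L α (ω + θ) = mulOp F L α ω + mulOp F L α θ := by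
  funext n v
  simp only [Pi.add_apply, mulOp_sum_apply, wedgeTerm]
  split_ifs
  · simp only [← Finset.sum_add_distrib]
    refine Finset.sum_congr rfl fun σ _ => ?_
    split_ifs <;> ring
  · simp

lemma mulOp_smul {p : ℕ} (α : RawCochain F L p) (c : F) (ω : RawCochains F L) :
    mulOp F L α (c • ω) = c • mulOp F L α ω := by
  funext n v
  simp only [Pi.smul_apply, smul_eq_mul, mulOp_sum_apply, wedgeTerm]
  split_ifs
  · simp only [Finset.mul_sum]
    refine Finset.sum_congr rfl fun σ _ => ?_
    split_ifs <;> ring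
  · simp

lemma mulOp_sub {p : ℕ} (α : RawCochain F L p) (ω θ : RawCochains F L) :
    mulOp F L α (ω - θ) = mulOp F L α ω - mulOp F L α θ := by
  rw [sub_eq_add_neg, ← neg_one_smul F θ, mulOp_add, mulOp_smul, neg_one_smul, ← sub_eq_add_neg]

/-- Two families agreeing after every contraction in degree `n` agree in
degree `n + 1`. -/
lemma eq_succ_of_contrOp {K g : Type*} {ω θ : RawCochains K g} {n : ℕ}
    (h : ∀ x, contrOp K g x ω n = contrOp K g x θ n) : ω (n + 1) = θ (n + 1) := by
  funext v
  rw [← Fin.cons_self_tail v]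
  exact congrFun (h (v 0)) (Fin.tail v)

lemma contrOp_add (x : L) (ω θ : RawCochains F L) :
    contrOp F L x (ω + θ) = contrOp F L x ω + contrOp F L x θ := rfl

lemma contrOp_sub (x : L) (ω θ : RawCochains F L) :
    contrOp F L x (ω - θ) = contrOp F L x ω - contrOp F L x θ := rfl

lemma contrOp_smul (x : L) (c : F) (ω : RawCochains F L) :
    contrOp F L x (c • ω) = c • contrOp F L x ω := rfl

lemma contrOp_mulOp_one (x : L) (ξ : RawCochain F L 1) (ω : RawCochains F L) :
    contrOp F L x (mulOp F L ξ ω) = ξ (fun _ => x) • ω - mulOp F L ξ (contrOp F L x ω) := by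
  rw [contrOp_mulOp, mulOp_zero_form, show (Fin.cons x Fin.elim0 : Fin 1 → L) = fun _ => x from
    funext (Fin.cases rfl fun i => i.elim0)]
  simp [sub_eq_add_neg]

/-- Wedge products with a `p`-form and with a `1`-form commute up to the sign `(-1) ^ p`. -/
lemma mulOp_mulOp_one (ξ : RawCochain F L 1) {p : ℕ} (α : RawCochain F L p)
    (ω : RawCochains F L) :
    mulOp F L α (mulOp F L ξ ω) = (-1 : F) ^ p • mulOp F L ξ (mulOp F L α ω) := by
  funext n
  induction n generalizing p ω with
  | zero =>
    cases p with
    | zero => simp [mulOp_zero_form, mulOp_smul]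
    | succ p =>
      rw [mulOp_of_lt (Nat.succ_pos p), Pi.smul_apply, mulOp_of_lt Nat.one_pos, smul_zero]
  | succ n ih =>
    cases p with
    | zero => simp [mulOp_zero_form, mulOp_smul]
    | succ p =>
      apply eq_succ_of_contrOp
      intro y
      simp only [contrOp_smul, contrOp_mulOp y α, contrOp_mulOp_one y ξ, mulOp_sub, mulOp_smul,
        mulOp_add, Pi.add_apply, Pi.sub_apply, Pi.smul_apply, ih]
      match_scalars <;> ring

/-- Skew-symmetry of a family of forms in its first `n + 1` arguments. -/
def IsSkewAt : ℕ → RawCochains F L → Prop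
  | 0, _ => True
  | n + 1, ω => (∀ x, IsSkewAt n (contrOp F L x ω)) ∧
      ∀ x y, contrOp F L x (contrOp F L y ω) = - contrOp F L y (contrOp F L x ω)

/-- Skew-symmetry of a family of forms. -/
def IsSkew (ω : RawCochains F L) : Prop := ∀ n, IsSkewAt n ω

lemma IsSkew.contrOp {ω : RawCochains F L} (h : IsSkew ω) (x : L) :
    IsSkew (contrOp F L x ω) := fun n => (h (n + 1)).1 x

lemma IsSkew.contrOp_comm {ω : RawCochains F L} (h : IsSkew ω) (x y : L) :
    _root_.contrOp F L x (_root_.contrOp F L y ω) =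
      - _root_.contrOp F L y (_root_.contrOp F L x ω) := (h 1).2 x y

lemma IsSkewAt.smul_sub {n : ℕ} {ω θ : RawCochains F L} (c : F) (hω : IsSkewAt n ω)
    (hθ : IsSkewAt n θ) : IsSkewAt n (c • ω - θ) := by
  induction n generalizing ω θ with
  | zero => trivial
  | succ n ih =>
    refine ⟨fun x => ih (hω.1 x) (hθ.1 x), fun x y => ?_⟩
    simp only [contrOp_sub, contrOp_smul]
    rw [hω.2 x y, hθ.2 x y]
    module

lemma IsSkew.mulOp_one {ω : RawCochains F L} (h : IsSkew ω) (ξ : RawCochain F L 1) :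
    IsSkew (mulOp F L ξ ω) := by
  intro n
  induction n generalizing ω with
  | zero => trivial
  | succ n ih =>
    refine ⟨fun x => ?_, fun x y => ?_⟩
    · rw [contrOp_mulOp_one]
      exact (h n).smul_sub _ (ih (h.contrOp x))
    · simp only [contrOp_mulOp_one, contrOp_sub, contrOp_smul]
      rw [h.contrOp_comm x y, ← neg_one_smul F (_root_.contrOp F L y (_root_.contrOp F L x ω)),
        mulOp_smul]
      module

/-- Moving the first argument of a skew-symmetric form to the `k`-th place. -/
lemma IsSkew.cons_removeNth {ω : RawCochains F L} (h : IsSkew ω) {n : ℕ} (k : Fin (n + 1)) (a : L)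
    (v : Fin (n + 1) → L) : ω (n + 1) (Fin.cons a (k.removeNth v)) =
      (-1) ^ (k : ℕ) * ω (n + 1) (Function.update v k a) := by
  induction n generalizing ω with
  | zero =>
    obtain rfl : k = 0 := Fin.fin_one_eq_zero k
    rw [← Fin.cons_self_tail v, Fin.update_cons_zero]
    simp
  | succ n ih =>
    induction k using Fin.cases with
    | zero =>
      rw [← Fin.cons_self_tail v, Fin.update_cons_zero]
      simp
    | succ k =>
      have hr : k.succ.removeNth v = Fin.cons (v 0) (k.removeNth (Fin.tail v)) := by
        funext i
        induction i using Fin.cases with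
        | zero => simp [Fin.removeNth]
        | succ i => simp [Fin.removeNth, Fin.tail]
      have hu : Function.update v k.succ a =
          Fin.cons (v 0) (Function.update (Fin.tail v) k a) := by
        rw [Fin.cons_update, Fin.cons_self_tail]
      have hc := congrFun (congrFun (h.contrOp_comm (v 0) a) n) (k.removeNth (Fin.tail v))
      have hi := ih (h.contrOp (v 0)) k (Fin.tail v)
      simp only [Pi.neg_apply, _root_.contrOp] at hc hi
      rw [hr, hu, Fin.val_succ, hc, hi]
      ring

lemma isSkew_toRaw [LieRing L] [LieAlgebra F L] (ω : ∀ n, Cochain F L n) :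
    IsSkew (toRaw F L ω) := by
  intro n
  induction n generalizing ω with
  | zero => trivial
  | succ n ih =>
    refine ⟨fun x => ih fun m => (ω (m + 1)).curryLeft x, fun x y => ?_⟩
    funext m v
    have h := (ω (m + 2)).map_swap (Fin.cons x (Fin.cons y v)) (i := 0) (j := 1) (by simp)
    refine Eq.trans (congrArg (ω (m + 2)) ?_) h
    funext i
    induction i using Fin.cases with
    | zero => simp
    | succ i =>
      induction i using Fin.cases with
      | zero => simp
      | succ i =>
        rw [Function.comp_apply, Equiv.swap_apply_of_ne_of_ne (by simp [Fin.ext_iff])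
          (by simp [Fin.ext_iff])]
        rfl

section Bracket

variable [LieRing L]

/-- The Lie derivative `(L_x ω)(v_1, …, v_n) = -∑ k, ω(v_1, …, ⁅x, v_k⁆, …, v_n)`. -/
def lieOp (x : L) (ω : RawCochains F L) : RawCochains F L :=
  fun n v => -∑ k, ω n (Function.update v k ⁅x, v k⁆)

lemma contrOp_lieOp (x y : L) (ω : RawCochains F L) :
    contrOp F L y (lieOp x ω) = lieOp x (contrOp F L y ω) - contrOp F L ⁅x, y⁆ ω := by
  funext n v
  simp only [contrOp, lieOp, Pi.sub_apply, Fin.sum_univ_succ, Fin.cons_zero, Fin.cons_succ,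
    Fin.update_cons_zero, Fin.cons_update]
  ring

lemma lieOp_smul_sub (x : L) (c : F) (ω θ : RawCochains F L) :
    lieOp x (c • ω - θ) = c • lieOp x ω - lieOp x θ := by
  funext n v
  simp only [lieOp, Pi.sub_apply, Pi.smul_apply, smul_eq_mul, Finset.sum_sub_distrib,
    ← Finset.mul_sum]
  ring

/-- The Lie derivative is a derivation of the product with a `1`-form. -/
lemma lieOp_mulOp_one (x : L) (ξ : RawCochain F L 1) (ω : RawCochains F L) :
    lieOp x (mulOp F L ξ ω) =
      mulOp F L (fun v : Fin 1 → L => -ξ fun _ => ⁅x, v 0⁆) ω + mulOp F L ξ (lieOp x ω) := by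
  funext n
  induction n generalizing ω with
  | zero =>
    funext v
    rw [Pi.add_apply, mulOp_of_lt Nat.one_pos, mulOp_of_lt Nat.one_pos]
    simp [lieOp]
  | succ n ih =>
    apply eq_succ_of_contrOp
    intro y
    simp only [contrOp_lieOp, contrOp_add, contrOp_mulOp_one, lieOp_smul_sub, mulOp_sub,
      Pi.add_apply, Pi.sub_apply, Pi.smul_apply, ih]
    module

lemma dOp_smul_sub (c : F) (ω θ : RawCochains F L) :
    dOp F L (c • ω - θ) = c • dOp F L ω - dOp F L θ := by
  funext n v
  cases n with
  | zero => simp [dOp]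
  | succ n =>
    simp only [dOp, ceDRaw, Pi.sub_apply, Pi.smul_apply, smul_eq_mul, Finset.mul_sum,
      ← Finset.sum_sub_distrib]
    refine Finset.sum_congr rfl fun j _ => Finset.sum_congr rfl fun i _ => ?_
    split_ifs <;> ring

/-- Cartan's formula `i_x d + d i_x = L_x` on skew-symmetric families. -/
lemma contrOp_dOp {ω : RawCochains F L} (h : IsSkew ω) (x : L) :
    contrOp F L x (dOp F L ω) = lieOp x ω - dOp F L (contrOp F L x ω) := by
  funext n v
  cases n with
  | zero => simp [contrOp, dOp, ceDRaw, lieOp]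
  | succ n =>
    simp only [Pi.sub_apply, lieOp, dOp]
    change ceDRaw F L (ω (n + 1)) (Fin.cons x v) = _
    rw [ceDRaw, Fin.sum_univ_succ, ceDRaw, ← Finset.sum_neg_distrib, ← Finset.sum_sub_distrib]
    simp only [Fin.val_zero, Nat.not_lt_zero, if_false, Finset.sum_const_zero, zero_add]
    refine Finset.sum_congr rfl fun j _ => ?_
    rw [Fin.sum_univ_succ, sub_eq_add_neg, ← Finset.sum_neg_distrib]
    congr 1
    · have hj := h.cons_removeNth j ⁅x, v j⁆ v
      rw [if_pos (by simp)]
      have : ((-1 : F) ^ (j : ℕ)) * (-1) ^ (j : ℕ) = 1 := by rw [← mul_pow]; simp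
      have e : ∀ u : Fin (n + 1) → L, u = Fin.cons ⁅x, v j⁆ (j.removeNth v) →
          (-1 : F) ^ (((0 : Fin (n + 2)) : ℕ) + (j.succ : ℕ)) * ω (n + 1) u =
            - ω (n + 1) (Function.update v j ⁅x, v j⁆) := by
        rintro u rfl
        rw [hj, Fin.val_zero, Fin.val_succ, zero_add, pow_succ]
        linear_combination (-ω (n + 1) (Function.update v j ⁅x, v j⁆)) * this
      apply e
      funext k
      induction k using Fin.cases with
      | zero => simp
      | succ k =>
        simp only [Fin.val_succ, Nat.succ_ne_zero, if_false, Fin.cons_succ, Fin.removeNth,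
          Fin.val_zero, Nat.not_lt_zero, Nat.add_lt_add_iff_right]
        rw [← Fin.cons_succ (α := fun _ => L) x v]
        congr 1
        ext
        simp only [Fin.succAbove, Fin.lt_def, Fin.val_succ, Fin.val_castSucc]
        split_ifs <;> simp
    · refine Finset.sum_congr rfl fun i _ => ?_
      by_cases hij : (i : ℕ) < j
      · rw [if_pos (by simpa using hij), if_pos hij]
        obtain ⟨m, rfl⟩ : ∃ m, n = m + 1 := ⟨n - 1, by omega⟩
        have hc := congrFun (congrFun (h.contrOp_comm x ⁅v i, v j⁆) m) fun k : Fin m =>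
          v ⟨if (k : ℕ) < i then k else if (k : ℕ) + 1 < j then k + 1 else k + 2, by
            split_ifs <;> omega⟩
        simp only [Pi.neg_apply, contrOp] at hc ⊢
        rw [← mul_neg]
        refine congrArg₂ _ (by simp only [Fin.val_succ]; ring) ?_
        refine Eq.trans (congrArg _ ?_) (hc.trans (congrArg (fun u => -ω (m + 2) u) ?_))
        · funext k
          induction k using Fin.cases with
          | zero => simp
          | succ k =>
            simp only [Fin.val_succ, Nat.succ_ne_zero, if_false, Fin.cons_succ,
              Nat.add_sub_cancel, Nat.add_lt_add_iff_right]
            induction k using Fin.cases with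
            | zero => simp
            | succ k =>
              rw [Fin.cons_succ, ← Fin.cons_succ (α := fun _ => L) x v]
              congr 1
              ext
              simp only [Fin.val_succ, Fin.succ_mk]
              split_ifs <;> omega
        · congr 1
          funext k
          induction k using Fin.cases with
          | zero => simp
          | succ k =>
            simp only [Fin.val_succ, Nat.succ_ne_zero, if_false, Fin.cons_succ,
              Nat.add_sub_cancel]
      · rw [if_neg (by simpa using hij), if_neg hij, neg_zero]

/-- `[e_ξ, d]₊ = e_{dξ}` for a `1`-form `ξ`. -/
lemma mulOp_dOp_add {ω : RawCochains F L} (h : IsSkew ω) (ξ : RawCochain F L 1) :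
    mulOp F L ξ (dOp F L ω) + dOp F L (mulOp F L ξ ω) = mulOp F L (ceDRaw F L ξ) ω := by
  funext n
  induction n generalizing ω with
  | zero =>
    rw [Pi.add_apply, mulOp_of_lt Nat.one_pos, mulOp_of_lt Nat.two_pos]
    simp [dOp]
  | succ n ih =>
    apply eq_succ_of_contrOp
    intro y
    have hd : (fun v : Fin 1 → L => ceDRaw F L ξ (Fin.cons y v)) =
        fun v => -ξ fun _ => ⁅y, v 0⁆ := by
      funext v
      simp [ceDRaw, Fin.sum_univ_succ]
    rw [contrOp_add, contrOp_dOp (h.mulOp_one ξ), contrOp_mulOp_one, contrOp_mulOp_one,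
      contrOp_dOp h, contrOp_mulOp, hd, lieOp_mulOp_one, dOp_smul_sub, mulOp_sub]
    simp only [Pi.add_apply, Pi.sub_apply, Pi.smul_apply, ← ih (h.contrOp y)]
    module

/-- `[i_x, d + e_ψ]₊ = L_x + e_{i_x ψ}` for a form `ψ` of degree `3`. -/
lemma acommOp_contrOp {ω : RawCochains F L} (h : IsSkew ω) (ψ : RawCochain F L 3) (x : L) :
    acommOp F L (contrOp F L x) (fun γ => dOp F L γ + mulOp F L ψ γ) ω =
      lieOp x ω + mulOp F L (fun w => ψ (Fin.cons x w)) ω := by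
  simp only [acommOp, contrOp_add, contrOp_dOp h, contrOp_mulOp x ψ]
  module

/-- `[e_ξ, d + e_ψ]₊ = e_{dξ}` for a `1`-form `ξ` and a form `ψ` of degree `3`. -/
lemma acommOp_mulOp {ω : RawCochains F L} (h : IsSkew ω) (ψ : RawCochain F L 3)
    (ξ : RawCochain F L 1) :
    acommOp F L (mulOp F L ξ) (fun γ => dOp F L γ + mulOp F L ψ γ) ω =
      mulOp F L (ceDRaw F L ξ) ω := by
  simp only [acommOp, mulOp_add, mulOp_mulOp_one ξ ψ, ← mulOp_dOp_add h ξ]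
  module

end Bracket

end Cartan

/-- **`D = d + e_ψ` is a deriving operator for the Courant bracket with
background `ψ`**: for a 3-cochain `ψ : Λ³g* `, all `x, y ∈ g`, `ξ, η ∈ g*`, and
every cochain `ω` (family of alternating forms),
(a) `[[i_x, D]₊, i_y]₋ = i_{⁅x,y⁆} − e_{ψ(x,y,·)}`;
(b) `[[i_x, D]₊, e_ξ]₋ = e_{ad*_x ξ}`;
(c) `[[e_ξ, D]₊, i_x]₋ = −e_{i_x dξ}`;
(d) `[[e_ξ, D]₊, e_η]₋ = 0`. -/
theorem deriving_operator_for_background_Courant_bracket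
    (ψ : Cochain K g 3) (x y : g) (ξ η : Module.Dual K g)
    (ω : ∀ n : ℕ, Cochain K g n) :
    (commOp K g
        (acommOp K g (contrOp K g x) (fun γ => dOp K g γ + mulOp K g (⇑ψ) γ))
        (contrOp K g y) (toRaw K g ω)
      = contrOp K g ⁅x, y⁆ (toRaw K g ω)
          - mulOp K g (fun v : Fin 1 → g => ψ ![x, y, v 0]) (toRaw K g ω)) ∧
    (commOp K g
        (acommOp K g (contrOp K g x) (fun γ => dOp K g γ + mulOp K g (⇑ψ) γ))
        (mulOp K g (fun v : Fin 1 → g => ξ (v 0))) (toRaw K g ω)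
      = mulOp K g (fun v : Fin 1 → g => coad K g x ξ (v 0)) (toRaw K g ω)) ∧
    (commOp K g
        (acommOp K g (mulOp K g (fun v : Fin 1 → g => ξ (v 0)))
          (fun γ => dOp K g γ + mulOp K g (⇑ψ) γ))
        (contrOp K g x) (toRaw K g ω)
      = - mulOp K g
            (fun v : Fin 1 → g =>
              ceDRaw K g (fun w : Fin 1 → g => ξ (w 0)) (Fin.cons x v))
            (toRaw K g ω)) ∧
    (commOp K g
        (acommOp K g (mulOp K g (fun v : Fin 1 → g => ξ (v 0)))
          (fun γ => dOp K g γ + mulOp K g (⇑ψ) γ))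
        (mulOp K g (fun v : Fin 1 → g => η (v 0))) (toRaw K g ω)
      = 0) := by
  have hω := isSkew_toRaw ω
  refine ⟨?_, ?_, ?_, ?_⟩
  · have hψ : (fun v : Fin 1 → g => ψ ![x, y, v 0]) =
        fun v => ψ (Fin.cons x (Fin.cons y v)) := by
      funext v
      congr 1
      funext i
      fin_cases i <;> rfl
    rw [commOp, acommOp_contrOp (hω.contrOp y), acommOp_contrOp hω, contrOp_add, contrOp_lieOp,
      contrOp_mulOp, hψ]
    module
  · have hξ : (fun v : Fin 1 → g => coad K g x ξ (v 0)) = fun v => -ξ ⁅x, v 0⁆ := rfl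
    rw [commOp, acommOp_contrOp (hω.mulOp_one _), acommOp_contrOp hω, mulOp_add,
      lieOp_mulOp_one, mulOp_mulOp_one, hξ]
    module
  · rw [commOp, acommOp_mulOp (hω.contrOp x), acommOp_mulOp hω, contrOp_mulOp]
    module
  · rw [commOp, acommOp_mulOp (hω.mulOp_one _), acommOp_mulOp hω, mulOp_mulOp_one]
    module

end DerivingOperator
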